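/- Suppose a family of sensing matrices {A_i}_{i=1}^m satisfies (2r, δ)-RIP with δ = 1/10 for the quadratic form H(M,M) = (1/m)Σ_i ⟨A_i, M⟩². Let M* = U*(U*)^T with U* ∈ ℝ^{d×r}, let U ∈ ℝ^{d×r}, Δ = U − U*R with R the optimal orthogonal alignment, M = UU^T, and f(U) = (1/2)(M − M*) : H : (M − M*). If ‖∇f(U)‖_F ≤ ε, then Δ : ∇²f(U) : Δ ≤ −0.4·σ_r(M*)·‖Δ‖_F² + 4ε‖Δ‖_F. Consequently, if additionally ∇²f(U) ⪰ 0, then ‖Δ‖_F ≤ 10ε/σ_r(M*). -/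

import Mathlib

open Matrix BigOperators

noncomputable section

attribute [local instance] Matrix.normedAddCommGroup Matrix.normedSpace

/-- Squared Frobenius norm of a real matrix. -/
def frobSq {m n : Type*} [Fintype m] [Fintype n] (A : Matrix m n ℝ) : ℝ :=
  ∑ i, ∑ j, (A i j) ^ 2

lemma frobSq_eq_trace {m n : Type*} [Fintype m] [Fintype n] (A : Matrix m n ℝ) :
    frobSq A = trace (A * Aᵀ) := by
  simp [frobSq, trace, mul_apply, sq]

lemma frobSq_nonneg {m n : Type*} [Fintype m] [Fintype n] (A : Matrix m n ℝ) :
    0 ≤ frobSq A :=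
  Finset.sum_nonneg fun _ _ => Finset.sum_nonneg fun _ _ => sq_nonneg _

lemma sum_mul_le_sqrt_frobSq {m n : Type*} [Fintype m] [Fintype n] (A B : Matrix m n ℝ) :
    ∑ i, ∑ j, A i j * B i j ≤ √(frobSq A) * √(frobSq B) := by
  rw [← Real.sqrt_mul (frobSq_nonneg A)]
  apply Real.le_sqrt_of_sq_le
  have h := Finset.sum_mul_sq_le_sq_mul_sq (Finset.univ : Finset (m × n))
    (fun p => A p.1 p.2) (fun p => B p.1 p.2)
  simpa only [frobSq, Fintype.sum_prod_type] using h

lemma rank_mul_transpose_sub_le {d r : ℕ} (U V : Matrix (Fin d) (Fin r) ℝ) :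
    (U * Uᵀ - V * Vᵀ).rank ≤ 2 * r := by
  have h : U * Uᵀ - V * Vᵀ = fromCols U V * fromRows Uᵀ (-Vᵀ) := by
    rw [fromCols_mul_fromRows, Matrix.mul_neg, sub_eq_add_neg]
  rw [h]
  refine (rank_mul_le_left _ _).trans ((rank_le_card_width _).trans ?_)
  simp [two_mul]

/-- The derivative and second derivative along a line, read off from a quartic expansion. -/
lemma fderiv_of_quartic_expansion {E : Type*} [NormedAddCommGroup E] [NormedSpace ℝ E]
    {f : E → ℝ} (hf : ContDiff ℝ 2 f) (x z : E) (a b c e g : ℝ)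
    (h : ∀ t : ℝ, f (x + t • z) = a + b * t + c * t ^ 2 + e * t ^ 3 + g * t ^ 4) :
    fderiv ℝ f x z = b ∧ iteratedFDeriv ℝ 2 f x ![z, z] = 2 * c := by
  have hline : ∀ t : ℝ, HasDerivAt (fun t : ℝ => x + t • z) z t := fun t => by
    simpa using ((hasDerivAt_id t).smul_const z).const_add x
  have h1 : ∀ t : ℝ,
      fderiv ℝ f (x + t • z) z = b + 2 * c * t + 3 * e * t ^ 2 + 4 * g * t ^ 3 := by
    intro t
    have hd : HasDerivAt (fun t : ℝ => f (x + t • z)) (fderiv ℝ f (x + t • z) z) t :=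
      ((hf.differentiable (by norm_num)) (x + t • z)).hasFDerivAt.comp_hasDerivAt t (hline t)
    have hp : HasDerivAt (fun t : ℝ => a + b * t + c * t ^ 2 + e * t ^ 3 + g * t ^ 4)
        (b + 2 * c * t + 3 * e * t ^ 2 + 4 * g * t ^ 3) t := by
      have := (((((hasDerivAt_id t).const_mul b).const_add a).add
        ((hasDerivAt_pow 2 t).const_mul c)).add ((hasDerivAt_pow 3 t).const_mul e)).add
        ((hasDerivAt_pow 4 t).const_mul g)
      refine this.congr_deriv ?_
      push_cast
      ring
    rw [funext h] at hd
    exact hd.unique hp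
  refine ⟨by simpa using h1 0, ?_⟩
  have hf1 : Differentiable ℝ (fderiv ℝ f) :=
    (hf.fderiv_right (m := 1) (by norm_num)).differentiable (by norm_num)
  have hd : HasDerivAt (fun t : ℝ => fderiv ℝ f (x + t • z) z)
      (fderiv ℝ (fderiv ℝ f) (x + (0 : ℝ) • z) z z) 0 := by
    have := (hf1 (x + (0 : ℝ) • z)).hasFDerivAt.comp_hasDerivAt (0 : ℝ) (hline 0)
    simpa using this.clm_apply (hasDerivAt_const (0 : ℝ) z)
  have hp : HasDerivAt (fun t : ℝ => b + 2 * c * t + 3 * e * t ^ 2 + 4 * g * t ^ 3)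
      (2 * c) 0 := by
    have := ((((hasDerivAt_id (0 : ℝ)).const_mul (2 * c)).const_add b).add
      ((hasDerivAt_pow 2 (0 : ℝ)).const_mul (3 * e))).add
      ((hasDerivAt_pow 3 (0 : ℝ)).const_mul (4 * g))
    refine this.congr_deriv ?_
    norm_num
  rw [funext h1] at hd
  rw [iteratedFDeriv_two_apply]
  simpa using hd.unique hp

/-- The linear functional `M ↦ ⟨A, M⟩`. -/
def frobPairing {m n : Type*} [Fintype m] [Fintype n] (A : Matrix m n ℝ) :
    Matrix m n ℝ →ₗ[ℝ] ℝ where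
  toFun M := ∑ a, ∑ b, A a b * M a b
  map_add' M N := by simp [mul_add, Finset.sum_add_distrib]
  map_smul' c M := by
    simp only [Matrix.smul_apply, smul_eq_mul, RingHom.id_apply, Finset.mul_sum]
    exact Finset.sum_congr rfl fun _ _ => Finset.sum_congr rfl fun _ _ => by ring

/-- The bilinear form `H(M, N) = (1/m) ∑ᵢ ⟨Aᵢ, M⟩ ⟨Aᵢ, N⟩`. -/
def sensingForm {m : ℕ} {p q : Type*} [Fintype p] [Fintype q] (A : Fin m → Matrix p q ℝ) :
    LinearMap.BilinForm ℝ (Matrix p q ℝ) :=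
  (1 / (m : ℝ)) • ∑ i, LinearMap.BilinForm.linMulLin (frobPairing (A i)) (frobPairing (A i))

lemma sensingForm_apply {m : ℕ} {p q : Type*} [Fintype p] [Fintype q]
    (A : Fin m → Matrix p q ℝ) (M N : Matrix p q ℝ) :
    sensingForm A M N = (1 / (m : ℝ)) *
      ∑ i, (∑ a, ∑ b, A i a b * M a b) * (∑ a, ∑ b, A i a b * N a b) := by
  simp [sensingForm, frobPairing]

lemma sensingForm_comm {m : ℕ} {p q : Type*} [Fintype p] [Fintype q]
    (A : Fin m → Matrix p q ℝ) (M N : Matrix p q ℝ) :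
    sensingForm A M N = sensingForm A N M := by
  simp only [sensingForm_apply, mul_comm]

lemma contDiff_sensingLoss {m d r : ℕ} (A : Fin m → Matrix (Fin d) (Fin d) ℝ)
    (N : Matrix (Fin d) (Fin d) ℝ) :
    ContDiff ℝ 2 fun W : Matrix (Fin d) (Fin r) ℝ =>
      (1 / 2 : ℝ) * sensingForm A (W * Wᵀ - N) (W * Wᵀ - N) := by
  have hentry : ∀ (i : Fin d) (k : Fin r),
      ContDiff ℝ 2 fun W : Matrix (Fin d) (Fin r) ℝ => W i k := fun i k =>
    (LinearMap.toContinuousLinearMap (entryLinearMap ℝ ℝ i k)).contDiff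
  have hpair : ∀ i, ContDiff ℝ 2 fun W : Matrix (Fin d) (Fin r) ℝ =>
      ∑ a, ∑ b, A i a b * (W * Wᵀ - N) a b := by
    intro i
    simp only [Matrix.sub_apply, mul_apply, transpose_apply]
    exact ContDiff.sum fun a _ => ContDiff.sum fun b _ => contDiff_const.mul
      ((ContDiff.sum fun k _ => (hentry a k).mul (hentry b k)).sub contDiff_const)
  simp only [sensingForm_apply]
  exact contDiff_const.mul (contDiff_const.mul
    (ContDiff.sum fun i _ => (hpair i).mul (hpair i)))

lemma sensingLoss_derivatives {m d r : ℕ} (A : Fin m → Matrix (Fin d) (Fin d) ℝ)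
    (N : Matrix (Fin d) (Fin d) ℝ) (U Z : Matrix (Fin d) (Fin r) ℝ) :
    fderiv ℝ (fun W : Matrix (Fin d) (Fin r) ℝ =>
        (1 / 2 : ℝ) * sensingForm A (W * Wᵀ - N) (W * Wᵀ - N)) U Z =
      sensingForm A (U * Uᵀ - N) (U * Zᵀ + Z * Uᵀ) ∧
    iteratedFDeriv ℝ 2 (fun W : Matrix (Fin d) (Fin r) ℝ =>
        (1 / 2 : ℝ) * sensingForm A (W * Wᵀ - N) (W * Wᵀ - N)) U ![Z, Z] =
      sensingForm A (U * Zᵀ + Z * Uᵀ) (U * Zᵀ + Z * Uᵀ) +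
        2 * sensingForm A (U * Uᵀ - N) (Z * Zᵀ) := by
  set D := U * Uᵀ - N with hD
  set L := U * Zᵀ + Z * Uᵀ with hL
  have hexp : ∀ t : ℝ, (U + t • Z) * (U + t • Z)ᵀ - N = D + t • L + t ^ 2 • (Z * Zᵀ) := by
    intro t
    simp only [hD, hL, transpose_add, transpose_smul, Matrix.add_mul, Matrix.mul_add,
      Matrix.smul_mul, Matrix.mul_smul, smul_add, smul_smul, sq]
    abel
  have key := fderiv_of_quartic_expansion (contDiff_sensingLoss A N) U Z
    (1 / 2 * sensingForm A D D) (sensingForm A D L)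
    (1 / 2 * sensingForm A L L + sensingForm A D (Z * Zᵀ))
    (sensingForm A L (Z * Zᵀ)) (1 / 2 * sensingForm A (Z * Zᵀ) (Z * Zᵀ)) (by
      intro t
      simp only [hexp, map_add, map_smul, LinearMap.add_apply, LinearMap.smul_apply, smul_eq_mul]
      rw [sensingForm_comm A L D, sensingForm_comm A (Z * Zᵀ) D, sensingForm_comm A (Z * Zᵀ) L]
      ring)
  refine ⟨key.1, key.2.trans ?_⟩
  ring

/-- A real square matrix whose trace does not increase under right multiplication by
orthogonal matrices is positive semidefinite. -/
lemma posSemidef_of_trace_mul_orthogonal_le {n : Type*} [Fintype n] [DecidableEq n]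
    (B : Matrix n n ℝ) (h : ∀ Z ∈ Matrix.orthogonalGroup n ℝ, trace (B * Z) ≤ trace B) :
    Bᵀ = B ∧ ∀ x, 0 ≤ x ⬝ᵥ B *ᵥ x := by
  have horth : ∀ v : n → ℝ, v ⬝ᵥ v ≠ 0 →
      (1 - (2 / (v ⬝ᵥ v)) • vecMulVec v v) ∈ Matrix.orthogonalGroup n ℝ := by
    intro v hv
    rw [Matrix.mem_orthogonalGroup_iff]
    have hc : (2 / (v ⬝ᵥ v)) * ((2 / (v ⬝ᵥ v)) * (v ⬝ᵥ v)) =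
        2 / (v ⬝ᵥ v) + 2 / (v ⬝ᵥ v) := by
      field_simp
      norm_num
    simp only [transpose_sub, transpose_one, transpose_smul, transpose_vecMulVec,
      Matrix.sub_mul, Matrix.mul_sub, Matrix.one_mul, Matrix.mul_one, Matrix.smul_mul,
      Matrix.mul_smul, vecMulVec_mul_vecMulVec, vecMulVec_smul, smul_sub, smul_smul]
    rw [hc, add_smul]
    abel
  have htr : ∀ v w : n → ℝ, trace (B * vecMulVec v w) = w ⬝ᵥ B *ᵥ v := by
    intro v w
    rw [mul_vecMulVec, trace_vecMulVec, dotProduct_comm]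
  have hpos : ∀ x, 0 ≤ x ⬝ᵥ B *ᵥ x := by
    intro x
    by_cases hx : x ⬝ᵥ x = 0
    · simp [dotProduct_self_eq_zero.mp hx]
    have hx0 : 0 < x ⬝ᵥ x :=
      lt_of_le_of_ne (Finset.sum_nonneg fun i _ => mul_self_nonneg (x i)) (Ne.symm hx)
    have h1 := h _ (horth x hx)
    rw [Matrix.mul_sub, Matrix.mul_one, trace_sub, Matrix.mul_smul, trace_smul, htr,
      smul_eq_mul] at h1
    have h2 : 0 ≤ 2 / (x ⬝ᵥ x) * (x ⬝ᵥ B *ᵥ x) := by linarith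
    exact nonneg_of_mul_nonneg_right h2 (by positivity)
  refine ⟨?_, hpos⟩
  ext i j
  rw [transpose_apply]
  by_cases hij : i = j
  · rw [hij]
  have hquad : ∀ t : ℝ, 0 ≤ t ^ 2 * (B i i + B j j) + t * (B i j - B j i) := by
    intro t
    set a : n → ℝ := Pi.single i 1 with ha
    set b : n → ℝ := Pi.single i 1 + t • Pi.single j 1 with hb
    have haa : a ⬝ᵥ a = 1 := by simp [ha]
    have hab : a ⬝ᵥ b = 1 := by simp [ha, hb, hij]
    have hbb : b ⬝ᵥ b = 1 + t ^ 2 := by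
      simp [hb, hij, Ne.symm hij, sq]
    have haBa : a ⬝ᵥ B *ᵥ a = B i i := by simp [ha]
    have hbBa : b ⬝ᵥ B *ᵥ a = B i i + t * B j i := by simp [ha, hb]
    have hbBb : b ⬝ᵥ B *ᵥ b = B i i + t * (B i j + B j i) + t ^ 2 * B j j := by
      simp [hb, mulVec_add, mulVec_smul]
      ring
    have ht : 0 < 1 + t ^ 2 := by positivity
    have h1 := h _ (mul_mem (horth a (by rw [haa]; norm_num)) (horth b (by rw [hbb]; exact ht.ne')))
    simp only [Matrix.sub_mul, Matrix.mul_sub, Matrix.one_mul, Matrix.mul_one, Matrix.smul_mul,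
      Matrix.mul_smul, vecMulVec_mul_vecMulVec, vecMulVec_smul, trace_sub, trace_smul, htr,
      smul_eq_mul, haa, hab, hbb, haBa, hbBa, hbBb] at h1
    have h2 : 0 ≤ (2 / (1 + t ^ 2)) * (t ^ 2 * (B i i + B j j) + t * (B i j - B j i)) := by
      have e : (2 / (1 + t ^ 2)) * (t ^ 2 * (B i i + B j j) + t * (B i j - B j i)) =
          2 / 1 * B i i + (2 / (1 + t ^ 2)) *
            (B i i + t * (B i j + B j i) + t ^ 2 * B j j) -
            2 / 1 * (2 / (1 + t ^ 2) * (1 * (B i i + t * B j i))) := by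
        field_simp
        ring
      rw [e]
      linarith
    exact nonneg_of_mul_nonneg_right h2 (by positivity)
  have hK : 0 ≤ B i i + B j j := by
    have h1 := hquad 1
    have h2 := hquad (-1)
    linarith
  set K := B i i + B j j
  set l := B i j - B j i with hl
  have h1 := hquad (-l / (K + 1))
  have h2 : (-l / (K + 1)) ^ 2 * K + (-l / (K + 1)) * l = -(l / (K + 1)) ^ 2 := by
    field_simp
    ring
  have h3 : l / (K + 1) = 0 := by
    rw [h2] at h1
    exact pow_eq_zero_iff (two_ne_zero) |>.mp (le_antisymm (by linarith) (sq_nonneg _))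
  have h4 : l = 0 := by
    rcases div_eq_zero_iff.mp h3 with h4 | h4
    · exact h4
    · linarith
  linarith

/-- At an optimal orthogonal alignment `V = U⋆R` of `U⋆` with `U`, the matrix `UᵀV` is
positive semidefinite. -/
lemma posSemidef_of_optimal_alignment {m n : Type*} [Fintype m] [Fintype n] [DecidableEq n]
    (U V : Matrix m n ℝ) (R : Matrix n n ℝ) (hR : R ∈ Matrix.orthogonalGroup n ℝ)
    (hmin : ∀ Z ∈ Matrix.orthogonalGroup n ℝ, frobSq (U - V * R) ≤ frobSq (U - V * Z)) :
    (Uᵀ * (V * R))ᵀ = Uᵀ * (V * R) ∧ ∀ x, 0 ≤ x ⬝ᵥ (Uᵀ * (V * R)) *ᵥ x := by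
  have hexp : ∀ Z ∈ Matrix.orthogonalGroup n ℝ,
      frobSq (U - V * Z) = frobSq U + frobSq V - 2 * trace (Uᵀ * (V * Z)) := by
    intro Z hZ
    rw [Matrix.mem_orthogonalGroup_iff] at hZ
    have e1 : trace (V * Z * Uᵀ) = trace (Uᵀ * (V * Z)) := trace_mul_comm _ _
    have e2 : trace (U * (V * Z)ᵀ) = trace (Uᵀ * (V * Z)) := by
      rw [← e1, ← trace_transpose, transpose_mul, transpose_transpose]
    have e3 : V * Z * (V * Z)ᵀ = V * Vᵀ := by
      rw [transpose_mul, Matrix.mul_assoc, ← Matrix.mul_assoc Z, hZ, Matrix.one_mul]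
    simp only [frobSq_eq_trace, transpose_sub, Matrix.sub_mul, Matrix.mul_sub, trace_sub]
    rw [e1, e2, e3]
    ring
  apply posSemidef_of_trace_mul_orthogonal_le
  intro Z hZ
  have h := hmin (R * Z) (mul_mem hR hZ)
  rw [hexp R hR, hexp _ (mul_mem hR hZ)] at h
  rw [Matrix.mul_assoc, Matrix.mul_assoc]
  linarith

lemma trace_mul_mul_transpose_eq_sum {m n : Type*} [Fintype m] [Fintype n]
    (X : Matrix m n ℝ) (B : Matrix n n ℝ) :
    trace (X * B * Xᵀ) = ∑ i, X i ⬝ᵥ B *ᵥ X i := by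
  simp only [trace, diag_apply]
  refine Finset.sum_congr rfl fun i _ => ?_
  rw [dotProduct_mulVec, mul_apply_eq_vecMul, dotProduct]
  simp [mul_apply, vecMul, dotProduct]

lemma trace_mul_self_nonneg_of_symm {n : Type*} [Fintype n] {T : Matrix n n ℝ} (hT : Tᵀ = T) :
    0 ≤ trace (T * T) := by
  have h := frobSq_nonneg T
  rwa [frobSq_eq_trace, hT] at h

/-- Comparison of `X Xᵀ - Y Yᵀ` with `X - Y` when `XᵀY` is positive semidefinite. -/
lemma frobSq_aligned_bounds {m n : Type*} [Fintype m] [Fintype n] (X Y : Matrix m n ℝ)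
    (hsymm : (Xᵀ * Y)ᵀ = Xᵀ * Y) (hpos : ∀ x, 0 ≤ x ⬝ᵥ (Xᵀ * Y) *ᵥ x) (σ : ℝ)
    (hσ : ∀ x : n → ℝ, σ * (∑ i, x i ^ 2) ≤ x ⬝ᵥ (Yᵀ * Y) *ᵥ x) :
    frobSq ((X - Y) * (X - Y)ᵀ) ≤ 2 * frobSq (X * Xᵀ - Y * Yᵀ) ∧
      0.8 * σ * frobSq (X - Y) ≤ frobSq (X * Xᵀ - Y * Yᵀ) := by
  obtain ⟨E, rfl⟩ : ∃ E, X = Y + E := ⟨X - Y, by abel⟩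
  rw [add_sub_cancel_left]
  set W := Eᵀ * E with hW
  set S := Yᵀ * E with hS
  set N := Yᵀ * Y with hN
  have hWt : Wᵀ = W := by simp [hW]
  have hNt : Nᵀ = N := by simp [hN]
  have hEY : Eᵀ * Y = Sᵀ := by simp [hS]
  have hP : (Y + E)ᵀ * Y = N + Sᵀ := by rw [transpose_add, Matrix.add_mul, hEY]
  have hSt : Sᵀ = S := by
    rw [hP, transpose_add, transpose_transpose, hNt] at hsymm
    exact (add_left_cancel hsymm).symm
  rw [hSt] at hEY hP
  have hcyc : ∀ a b c e : Matrix m n ℝ,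
      trace (a * bᵀ * (c * eᵀ)) = trace (eᵀ * a * (bᵀ * c)) := by
    intro a b c e
    rw [← Matrix.mul_assoc, trace_mul_comm, Matrix.mul_assoc, Matrix.mul_assoc]
  have hE : frobSq (E * Eᵀ) = trace (W * W) := by
    rw [frobSq_eq_trace, transpose_mul, transpose_transpose, hcyc]
  have hD : frobSq ((Y + E) * (Y + E)ᵀ - Y * Yᵀ) =
      trace (W * W) + 4 * trace (W * S) + 2 * trace (S * S) + 2 * trace (W * N) := by
    have e : (Y + E) * (Y + E)ᵀ - Y * Yᵀ = Y * Eᵀ + E * Yᵀ + E * Eᵀ := by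
      simp only [transpose_add, Matrix.add_mul, Matrix.mul_add]
      abel
    rw [e, frobSq_eq_trace]
    simp only [transpose_add, transpose_mul, transpose_transpose, Matrix.add_mul,
      Matrix.mul_add, trace_add, hcyc, hEY, ← hW, ← hS, ← hN]
    rw [trace_mul_comm S W, trace_mul_comm N W]
    ring
  have hWB : ∀ B : Matrix n n ℝ, trace (W * B) = ∑ i, E i ⬝ᵥ B *ᵥ E i := by
    intro B
    rw [← trace_mul_mul_transpose_eq_sum, hW, trace_mul_comm (E * B), Matrix.mul_assoc]
  have h1 : 0 ≤ trace (W * N) + trace (W * S) := by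
    rw [← trace_add, ← Matrix.mul_add, hWB]
    refine Finset.sum_nonneg fun i _ => ?_
    rw [← hP]
    exact hpos _
  have h2 : σ * frobSq E ≤ trace (W * N) := by
    rw [hWB, frobSq, Finset.mul_sum]
    exact Finset.sum_le_sum fun i _ => hσ (E i)
  have hsq : ∀ c : ℝ,
      0 ≤ trace (W * W) + 2 * c * trace (W * S) + c ^ 2 * trace (S * S) := by
    intro c
    have h := trace_mul_self_nonneg_of_symm (T := W + c • S)
      (by rw [transpose_add, transpose_smul, hWt, hSt])
    simp only [Matrix.add_mul, Matrix.mul_add, Matrix.smul_mul, Matrix.mul_smul, trace_add,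
      trace_smul, smul_eq_mul, trace_mul_comm S W] at h
    linarith
  have h3 := trace_mul_self_nonneg_of_symm hSt
  rw [hE, hD]
  constructor
  · have := hsq 2
    linarith
  · have := hsq 1.4
    norm_num at this ⊢
    linarith

/-- Symmetric matrix sensing under `(2r, 1/10)`-RIP: at any `U` with small gradient,
the Hessian along the aligned direction `Δ = U − U*R` is very negative:
`Δ:∇²f(U):Δ ≤ −0.4σ_r(M*)‖Δ‖_F² + 4ε‖Δ‖_F`; hence if moreover `∇²f(U) ⪰ 0` then
`‖Δ‖_F ≤ 10ε/σ_r(M*)`. Here `σr` is a lower bound on the eigenvalues of `(U*)ᵀU*`,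
i.e. on `σ_r(M*)`. -/
theorem stmt10 {d r m : ℕ} (A : Fin m → Matrix (Fin d) (Fin d) ℝ)
    (Hform : Matrix (Fin d) (Fin d) ℝ → Matrix (Fin d) (Fin d) ℝ → ℝ)
    (hHform : Hform = fun M N =>
      (1 / (m : ℝ)) * ∑ i, (∑ a, ∑ b, A i a b * M a b) * (∑ a, ∑ b, A i a b * N a b))
    (hRIP : ∀ M : Matrix (Fin d) (Fin d) ℝ, M.rank ≤ 2 * r →
      (1 - 1 / 10) * frobSq M ≤ Hform M M ∧ Hform M M ≤ (1 + 1 / 10) * frobSq M)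
    (Ustar U : Matrix (Fin d) (Fin r) ℝ)
    (f : Matrix (Fin d) (Fin r) ℝ → ℝ)
    (hf : f = fun W =>
      (1 / 2) * Hform (W * Wᵀ - Ustar * Ustarᵀ) (W * Wᵀ - Ustar * Ustarᵀ))
    (R : Matrix (Fin r) (Fin r) ℝ) (hR : R ∈ Matrix.orthogonalGroup (Fin r) ℝ)
    (hmin : ∀ Z ∈ Matrix.orthogonalGroup (Fin r) ℝ,
      frobSq (U - Ustar * R) ≤ frobSq (U - Ustar * Z))
    (σr : ℝ) (hσpos : 0 < σr)
    (hσ : ∀ x : Fin r → ℝ, σr * (∑ i, x i ^ 2) ≤ x ⬝ᵥ (Ustarᵀ * Ustar).mulVec x)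
    (G : Matrix (Fin d) (Fin r) ℝ)
    (hgrad : ∀ Z : Matrix (Fin d) (Fin r) ℝ, fderiv ℝ f U Z = ∑ i, ∑ j, G i j * Z i j)
    (ε : ℝ) (hε0 : 0 ≤ ε) (hG : Real.sqrt (frobSq G) ≤ ε) :
    iteratedFDeriv ℝ 2 f U ![U - Ustar * R, U - Ustar * R] ≤
        -0.4 * σr * frobSq (U - Ustar * R) +
          4 * ε * Real.sqrt (frobSq (U - Ustar * R)) ∧
      ((∀ Z : Matrix (Fin d) (Fin r) ℝ, 0 ≤ iteratedFDeriv ℝ 2 f U ![Z, Z]) →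
        Real.sqrt (frobSq (U - Ustar * R)) ≤ 10 * ε / σr) := by
  set Y := Ustar * R with hY
  have hYY : Y * Yᵀ = Ustar * Ustarᵀ := by
    rw [hY, transpose_mul, Matrix.mul_assoc, ← Matrix.mul_assoc R,
      (Matrix.mem_orthogonalGroup_iff _ _).mp hR, Matrix.one_mul]
  have hσY : ∀ x : Fin r → ℝ, σr * (∑ i, x i ^ 2) ≤ x ⬝ᵥ (Yᵀ * Y) *ᵥ x := by
    intro x
    have h := hσ (R *ᵥ x)
    have e1 : ∑ i, (R *ᵥ x) i ^ 2 = ∑ i, x i ^ 2 := by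
      have : (R *ᵥ x) ⬝ᵥ (R *ᵥ x) = x ⬝ᵥ x := by
        rw [dotProduct_mulVec, ← mulVec_transpose, mulVec_mulVec,
          (Matrix.mem_orthogonalGroup_iff' _ _).mp hR, one_mulVec]
      simpa [dotProduct, sq] using this
    have e2 : (R *ᵥ x) ⬝ᵥ (Ustarᵀ * Ustar) *ᵥ (R *ᵥ x) = x ⬝ᵥ (Yᵀ * Y) *ᵥ x := by
      rw [mulVec_mulVec, dotProduct_comm, dotProduct_mulVec, ← mulVec_transpose,
        mulVec_mulVec, dotProduct_comm, hY]
      simp only [transpose_mul, Matrix.mul_assoc]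
    rwa [e1, e2] at h
  obtain ⟨hsymm, hpos⟩ := posSemidef_of_optimal_alignment U Ustar R hR hmin
  obtain ⟨hb1, hb2⟩ := frobSq_aligned_bounds U Y hsymm hpos σr hσY
  have hH : ∀ M N, Hform M N = sensingForm A M N := fun M N => by
    rw [hHform, sensingForm_apply]
  simp only [hH] at hRIP hf
  obtain ⟨hfd, hhess⟩ := sensingLoss_derivatives A (Ustar * Ustarᵀ) U (U - Y)
  rw [← hf, ← hYY] at hfd hhess
  rw [hgrad] at hfd
  have hL : U * (U - Y)ᵀ + (U - Y) * Uᵀ =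
      (U * Uᵀ - Y * Yᵀ) + (U - Y) * (U - Y)ᵀ := by
    simp only [transpose_sub, Matrix.sub_mul, Matrix.mul_sub]
    abel
  have hinner := sum_mul_le_sqrt_frobSq G (U - Y)
  have hmul : √(frobSq G) * √(frobSq (U - Y)) ≤ ε * √(frobSq (U - Y)) :=
    mul_le_mul_of_nonneg_right hG (Real.sqrt_nonneg _)
  have hD := (hRIP _ (rank_mul_transpose_sub_le U Y)).1
  have hE := (hRIP ((U - Y) * (U - Y)ᵀ)
    ((rank_mul_le_left _ _).trans ((rank_le_width _).trans (by omega)))).2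
  rw [hL] at hfd hhess
  simp only [map_add, LinearMap.add_apply] at hfd hhess
  rw [sensingForm_comm A ((U - Y) * (U - Y)ᵀ) (U * Uᵀ - Y * Yᵀ)] at hhess
  have hmain : iteratedFDeriv ℝ 2 f U ![U - Y, U - Y] ≤
      -0.4 * σr * frobSq (U - Y) + 4 * ε * √(frobSq (U - Y)) := by
    rw [hhess]
    linarith
  refine ⟨hmain, fun hpsd => ?_⟩
  have h0 := (hpsd (U - Y)).trans hmain
  rw [le_div_iff₀ hσpos]
  have hs := Real.sq_sqrt (frobSq_nonneg (U - Y))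
  set s := √(frobSq (U - Y))
  rcases (Real.sqrt_nonneg (frobSq (U - Y))).eq_or_lt with hs0 | hs0
  · rw [show s = 0 from hs0.symm]
    linarith
  · rw [← hs] at h0
    norm_num at h0
    refine le_of_mul_le_mul_right ?_ hs0
    linarith
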